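/- Let 𝔛 be a Bourgain–Delbaen space with constant C = sup_q ‖i_q‖, and assume there is a decreasing sequence (ε_q)_{q=1}^∞ of positive reals with 2C² ∑_q ε_q < 1 such that for every q ≥ 1 there exist distinct γ_1^q, γ_2^q ∈ Δ_q satisfying ‖e_{γ_1^q}* ∘ i_p ∘ r_p − e_{γ_2^q}* ∘ i_p ∘ r_p‖ < ε_q (as functionals on 𝔛) for all p = 0, 1, …, q−1. Then 𝔛 contains an infinite-dimensional L∞-subspace Z; specifically, the subspace Z which is the closed linear span of {d_γ : γ ∈ Γ \ S} ∪ {d_{γ_1^q} + d_{γ_2^q} : q ≥ 1}, where S = {γ_1^q, γ_2^q : q ≥ 1}, is an infinite-dimensional L∞-space. -/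

import Mathlib

open scoped ENNReal
open Filter Topology

set_option maxHeartbeats 1000000
set_option synthInstance.maxHeartbeats 400000

noncomputable section

/-- `ℓ∞(Γ)`. -/
abbrev Linf (Γ : Type*) : Type _ := lp (fun _ : Γ => ℝ) ∞

namespace BD

variable {Γ : Type*}

/-- The evaluation map on `ℓ∞(Γ)`, as a linear map. -/
def evalLM (γ : Γ) : Linf Γ →ₗ[ℝ] ℝ where
  toFun f := f γ
  map_add' f g := by simp
  map_smul' c f := by simp

/-- The evaluation functional `e_γ^*` on `ℓ∞(Γ)`. -/
def evalL (γ : Γ) : Linf Γ →L[ℝ] ℝ :=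
  LinearMap.mkContinuous (evalLM γ) 1 fun f => by
    rw [one_mul]
    exact lp.norm_apply_le_norm ENNReal.top_ne_zero f γ

/-- The restriction map `ℓ∞(Γ) → ℓ∞(A)`, as a linear map. -/
def restrLM (A : Finset Γ) : Linf Γ →ₗ[ℝ] (↥A → ℝ) where
  toFun f γ := f γ.1
  map_add' f g := by ext γ; simp
  map_smul' c f := by ext γ; simp

/-- The restriction operator `r_A : ℓ∞(Γ) → ℓ∞(A)` for a finite set `A ⊆ Γ`. -/
def restrCLM (A : Finset Γ) : Linf Γ →L[ℝ] (↥A → ℝ) :=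
  LinearMap.mkContinuous (restrLM A) 1 fun f => by
    rw [one_mul]
    refine (pi_norm_le_iff_of_nonneg (norm_nonneg f)).2 fun γ => ?_
    exact lp.norm_apply_le_norm ENNReal.top_ne_zero f γ.1

/-- The data defining a Bourgain-Delbaen space: a strictly increasing sequence of
nonempty finite subsets of `Γ` covering `Γ`, together with a uniformly bounded compatible
sequence of extension operators. -/
structure System (Γ : Type*) where
  Γs : ℕ → Finset Γ
  strict : StrictMono Γs
  nonempty : ∀ q, (Γs q).Nonempty
  covers : ∀ γ : Γ, ∃ q, γ ∈ Γs q
  i : ∀ q, (↥(Γs q) → ℝ) →L[ℝ] Linf Γ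
  extension : ∀ q (x : ↥(Γs q) → ℝ) (γ : ↥(Γs q)), i q x γ.1 = x γ
  compat : ∀ p q, p < q → ∀ x : ↥(Γs p) → ℝ, i p x = i q (restrCLM (Γs q) (i p x))
  bdd : BddAbove (Set.range fun q => ‖i q‖)

/-- `C = sup_q ‖i_q‖`. -/
def System.C (S : System Γ) : ℝ := ⨆ q, ‖S.i q‖

/-- `Δ_0 = Γ_0`, `Δ_q = Γ_q \ Γ_{q-1}`. -/
def System.Δ (S : System Γ) : ℕ → Finset Γ := fun q =>
  letI := Classical.decEq Γ
  match q with
  | 0 => S.Γs 0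
  | q + 1 => S.Γs (q + 1) \ S.Γs q

/-- The unique `q` with `γ ∈ Δ_q`. -/
def System.rk (S : System Γ) (γ : Γ) : ℕ :=
  letI := Classical.decEq Γ
  Nat.find (S.covers γ)

/-- The vector `d_γ = i_q (e_γ)` for `γ ∈ Δ_q`. -/
def System.dvec (S : System Γ) (γ : Γ) : Linf Γ :=
  letI := Classical.decEq Γ
  S.i (S.rk γ) fun δ => if (δ : Γ) = γ then 1 else 0

/-- `M_q = span {d_γ : γ ∈ Δ_q}`. -/
def System.M (S : System Γ) (q : ℕ) : Submodule ℝ (Linf Γ) :=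
  Submodule.span ℝ (S.dvec '' (S.Δ q : Set Γ))

/-- The Bourgain-Delbaen space: the closed linear span of the `d_γ`'s in `ℓ∞(Γ)`. -/
def System.space (S : System Γ) : Submodule ℝ (Linf Γ) :=
  (Submodule.span ℝ (Set.range S.dvec)).topologicalClosure


section ShortcutInstances

noncomputable instance (priority := 10000) instLinfNACG (Γ : Type*) :
    NormedAddCommGroup (Linf Γ) := inferInstance

noncomputable instance (priority := 10000) instLinfNS (Γ : Type*) :
    NormedSpace ℝ (Linf Γ) := inferInstance

noncomputable instance (priority := 10000) instSpaceNACG (S : System Γ) :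
    NormedAddCommGroup ↥S.space := inferInstance

noncomputable instance (priority := 10000) instSpaceNS (S : System Γ) :
    NormedSpace ℝ ↥S.space := inferInstance

noncomputable instance (priority := 10000) instDualNACG (S : System Γ) :
    NormedAddCommGroup (↥S.space →L[ℝ] ℝ) := inferInstance

noncomputable instance (priority := 10000) instDualNS (S : System Γ) :
    NormedSpace ℝ (↥S.space →L[ℝ] ℝ) := inferInstance

end ShortcutInstances

lemma dvec_mem (S : System Γ) (γ : Γ) : S.dvec γ ∈ S.space :=
  Submodule.le_topologicalClosure _ (Submodule.subset_span ⟨γ, rfl⟩)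

end BD

namespace BD

variable {Γ : Type*}

/-- The evaluation functional `e_γ^*` restricted to the Bourgain–Delbaen space. -/
def evalS (S : System Γ) (γ : Γ) : ↥S.space →L[ℝ] ℝ :=
  (evalL γ).comp S.space.subtypeL

/-- The functional `e_γ^* ∘ i_p ∘ r_p` on the Bourgain–Delbaen space. -/
def cAt (S : System Γ) (p : ℕ) (γ : Γ) : ↥S.space →L[ℝ] ℝ :=
  ((evalL γ).comp ((S.i p).comp (restrCLM (S.Γs p)))).comp S.space.subtypeL

/-- `c_γ^* = 0` if `γ ∈ Δ_0`, and `c_γ^* = e_γ^* ∘ i_q ∘ r_q` if `γ ∈ Δ_{q+1}`. -/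
def cstar (S : System Γ) (γ : Γ) : ↥S.space →L[ℝ] ℝ :=
  if S.rk γ = 0 then 0 else cAt S (S.rk γ - 1) γ

/-- `d_γ^* = e_γ^* - c_γ^*`. -/
def dstar (S : System Γ) (γ : Γ) : ↥S.space →L[ℝ] ℝ :=
  evalS S γ - cstar S γ

end BD

namespace BD

variable {Γ : Type*}

/-- The subspace `Z`: the closed linear span of
`{d_γ : γ ∉ {γ₁^q, γ₂^q : q ≥ 1}} ∪ {d_{γ₁^q} + d_{γ₂^q} : q ≥ 1}`. -/
def Zsub (S : System Γ) (γ₁ γ₂ : ℕ → Γ) : Submodule ℝ (Linf Γ) :=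
  (Submodule.span ℝ
    ((S.dvec '' {γ | ¬∃ q, 1 ≤ q ∧ (γ = γ₁ q ∨ γ = γ₂ q)}) ∪
      Set.range fun q : ℕ => S.dvec (γ₁ (q + 1)) + S.dvec (γ₂ (q + 1)))).topologicalClosure

end BD

/-- A Banach space `X` is an `L_{∞,C}`-space if every finite dimensional subspace is contained
in a finite dimensional subspace `G` which is `C`-isomorphic to `ℓ∞^{dim G}`. -/
def IsLinftyCSpace (X : Type*) [NormedAddCommGroup X] [NormedSpace ℝ X] (C : ℝ) : Prop :=
  ∀ F : Submodule ℝ X, FiniteDimensional ℝ ↥F →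
    ∃ G : Submodule ℝ X, F ≤ G ∧ FiniteDimensional ℝ ↥G ∧
      ∃ T : ↥G ≃L[ℝ] (Fin (Module.finrank ℝ ↥G) → ℝ),
        ‖(T : ↥G →L[ℝ] (Fin (Module.finrank ℝ ↥G) → ℝ))‖ *
          ‖(T.symm : (Fin (Module.finrank ℝ ↥G) → ℝ) →L[ℝ] ↥G)‖ ≤ C

/-- A Banach space is an `L_∞`-space if it is an `L_{∞,C}`-space for some `C ≥ 1`. -/
def IsLinftySpace (X : Type*) [NormedAddCommGroup X] [NormedSpace ℝ X] : Prop :=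
  ∃ C : ℝ, 1 ≤ C ∧ IsLinftyCSpace X C

/-- If an increasing sequence of subspaces of a Banach space has dense union and its members are
uniformly isomorphic to finite dimensional `ℓ∞`-spaces, then the Banach space is an `L_∞`-space. -/
lemma IsLinftyCSpace.of_monotone_dense {X : Type*} [NormedAddCommGroup X] [NormedSpace ℝ X]
    [CompleteSpace X] {V : ℕ → Submodule ℝ X} (hV : Monotone V)
    (hdense : ∀ x : X, ∀ ε > 0, ∃ q, ∃ v ∈ V q, ‖v - x‖ < ε) {K : ℝ} (hK : 0 ≤ K)
    (hT : ∀ q, ∃ (n : ℕ) (T : ↥(V q) ≃ₗ[ℝ] (Fin n → ℝ)),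
      ∀ v, ‖T v‖ ≤ ‖v‖ ∧ ‖v‖ ≤ K * ‖T v‖) :
    IsLinftyCSpace X (3 * K) := by
  intro F hF
  let b := Module.finBasis ℝ F
  choose ψ hψ using fun j => exists_extension_norm_eq F (LinearMap.toContinuousLinearMap (b.coord j))
  set s : ℝ := ∑ j, ‖ψ j‖ with hs
  have hs0 : 0 ≤ s := Finset.sum_nonneg fun j _ => norm_nonneg _
  have hδ : 0 < 1 / (2 * (1 + s)) := by positivity
  choose q z hz hzb using fun j => hdense (b j) _ hδ
  set Q : ℕ := Finset.univ.sup q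
  have hzQ : ∀ j, z j ∈ V Q := fun j => hV (Finset.le_sup (Finset.mem_univ j)) (hz j)
  set E : X →L[ℝ] X := ∑ j, (ψ j).smulRight ((b j : X) - z j) with hE
  have hEnorm : ‖E‖ ≤ 1 / 2 := by
    calc ‖E‖ ≤ ∑ j, ‖ψ j‖ * (1 / (2 * (1 + s))) := by
          refine norm_sum_le_of_le _ fun j _ => ?_
          rw [ContinuousLinearMap.norm_smulRight_apply, norm_sub_rev]
          exact mul_le_mul_of_nonneg_left (hzb j).le (norm_nonneg _)
      _ = s / (2 * (1 + s)) := by rw [← Finset.sum_mul, ← hs]; ring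
      _ ≤ 1 / 2 := by rw [div_le_div_iff₀ (by positivity) (by positivity)]; linarith
  have hEx : ∀ x, ‖E x‖ ≤ 1 / 2 * ‖x‖ := fun x =>
    (E.le_opNorm x).trans (mul_le_mul_of_nonneg_right hEnorm (norm_nonneg x))
  obtain ⟨u, hu⟩ := isUnit_one_sub_of_norm_lt_one (hEnorm.trans_lt (by norm_num))
  let A : X ≃L[ℝ] X := ContinuousLinearEquiv.unitsEquiv ℝ X u
  have hA : ∀ x, A x = x - E x := fun x => by
    change (u : X →L[ℝ] X) x = _
    rw [hu]; simp
  have hAF : ∀ f ∈ F, A f ∈ V Q := by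
    intro f hf
    have h1 : E f = ∑ j, b.coord j ⟨f, hf⟩ • ((b j : X) - z j) := by
      simp only [hE, _root_.sum_apply, ContinuousLinearMap.smulRight_apply]
      exact Finset.sum_congr rfl fun j _ => by rw [show ψ j f = _ from (hψ j).1 ⟨f, hf⟩]; rfl
    have h2 : f = ∑ j, b.coord j ⟨f, hf⟩ • (b j : X) := by
      have := congrArg F.subtype (b.sum_repr ⟨f, hf⟩)
      rw [map_sum] at this
      exact this.symm
    have h3 : A f = ∑ j, b.coord j ⟨f, hf⟩ • z j := by
      rw [hA, h1]
      conv_lhs => enter [1]; rw [h2]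
      rw [← Finset.sum_sub_distrib]
      exact Finset.sum_congr rfl fun j _ => by rw [smul_sub]; abel
    rw [h3]
    exact Submodule.sum_mem _ fun j _ => Submodule.smul_mem _ _ (hzQ j)
  obtain ⟨n, T, hTn⟩ := hT Q
  let G : Submodule ℝ X := (V Q).map (A.symm.toLinearEquiv : X →ₗ[ℝ] X)
  let B : ↥G ≃ₗ[ℝ] ↥(V Q) := (A.symm.toLinearEquiv.submoduleMap (V Q)).symm
  have hB : ∀ x : G, ((B x : V Q) : X) = A x := by
    intro x
    obtain ⟨y, rfl⟩ := B.symm.surjective x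
    rw [LinearEquiv.apply_symm_apply]
    exact (A.apply_symm_apply (y : X)).symm
  have hfd : FiniteDimensional ℝ G := (B.trans T).symm.finiteDimensional
  have hn : Module.finrank ℝ G = n := by simpa using (B.trans T).finrank_eq
  subst hn
  refine ⟨G, fun f hf => ⟨A f, hAF f hf, A.symm_apply_apply f⟩, hfd,
    (B.trans T).toContinuousLinearEquiv, ?_⟩
  have hup : ‖(((B.trans T).toContinuousLinearEquiv : ↥G ≃L[ℝ] _) :
      ↥G →L[ℝ] (Fin (Module.finrank ℝ ↥G) → ℝ))‖ ≤ 3 / 2 := by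
    refine ContinuousLinearMap.opNorm_le_bound _ (by norm_num) fun x => ?_
    change ‖T (B x)‖ ≤ _
    refine (hTn _).1.trans ?_
    rw [Submodule.coe_norm, hB, hA]
    refine (norm_sub_le _ _).trans ?_
    have := hEx x
    rw [Submodule.coe_norm]
    linarith
  have hlow : ‖(((B.trans T).toContinuousLinearEquiv : ↥G ≃L[ℝ] _).symm :
      (Fin (Module.finrank ℝ ↥G) → ℝ) →L[ℝ] ↥G)‖ ≤ 2 * K := by
    refine ContinuousLinearMap.opNorm_le_bound _ (by positivity) fun y => ?_
    obtain ⟨x, rfl⟩ := (B.trans T).surjective y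
    change ‖(B.trans T).symm (B.trans T x)‖ ≤ 2 * K * ‖T (B x)‖
    rw [LinearEquiv.symm_apply_apply]
    have h1 := (hTn (B x)).2
    rw [Submodule.coe_norm, hB, hA] at h1
    have h2 := norm_sub_norm_le (x : X) (E x)
    have h3 := hEx x
    rw [Submodule.coe_norm]
    linarith
  calc _ ≤ 3 / 2 * (2 * K) := mul_le_mul hup hlow (ContinuousLinearMap.opNorm_nonneg _) (by norm_num)
    _ = 3 * K := by ring

namespace BD

variable {Γ : Type*} (S : System Γ)

lemma mem_Γs_iff {γ : Γ} {q : ℕ} : γ ∈ S.Γs q ↔ S.rk γ ≤ q := by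
  classical
  unfold System.rk
  rw [Nat.find_le_iff]
  exact ⟨fun h => ⟨q, le_rfl, h⟩, fun ⟨m, hm, h⟩ => S.strict.monotone hm h⟩

lemma rk_eq_of_mem_Δ {γ : Γ} {q : ℕ} (h : γ ∈ S.Δ q) : S.rk γ = q := by
  cases q with
  | zero => exact Nat.le_zero.1 ((mem_Γs_iff S).1 h)
  | succ q =>
    simp only [System.Δ, Finset.mem_sdiff, mem_Γs_iff] at h
    omega

lemma norm_i_le (q : ℕ) : ‖S.i q‖ ≤ S.C := le_ciSup S.bdd q

lemma restrCLM_apply (A : Finset Γ) (x : Linf Γ) (γ : ↥A) : restrCLM A x γ = x γ := rfl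

lemma one_le_C : 1 ≤ S.C := by
  obtain ⟨γ, hγ⟩ := S.nonempty 0
  have h1 : ‖S.i 0 1 γ‖ = 1 := by rw [S.extension 0 1 ⟨γ, hγ⟩]; simp
  have : Nonempty ↥(S.Γs 0) := ⟨⟨γ, hγ⟩⟩
  calc (1 : ℝ) = ‖S.i 0 1 γ‖ := h1.symm
    _ ≤ ‖S.i 0 1‖ := lp.norm_apply_le_norm ENNReal.top_ne_zero _ γ
    _ ≤ ‖S.i 0‖ * ‖(1 : ↥(S.Γs 0) → ℝ)‖ := (S.i 0).le_opNorm 1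
    _ = ‖S.i 0‖ := by rw [norm_one, mul_one]
    _ ≤ S.C := norm_i_le S 0

lemma i_restrCLM_dvec {γ : Γ} {q : ℕ} (h : S.rk γ ≤ q) :
    S.i q (restrCLM (S.Γs q) (S.dvec γ)) = S.dvec γ := by
  rcases h.lt_or_eq with h | rfl
  · exact (S.compat _ _ h _).symm
  · unfold System.dvec
    congr 1
    ext δ
    rw [restrCLM_apply, S.extension]

lemma dvec_apply {γ δ : Γ} [Decidable (γ = δ)] (h : S.rk γ ≤ S.rk δ) :
    S.dvec δ γ = if γ = δ then 1 else 0 := by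
  classical
  unfold System.dvec
  rw [S.extension _ _ ⟨γ, (mem_Γs_iff S).2 h⟩]
  congr

/-- The coefficient functional `d_γ^*`, defined on all of `ℓ∞(Γ)`. -/
def coeff (γ : Γ) : Linf Γ →ₗ[ℝ] ℝ :=
  evalLM γ - if S.rk γ = 0 then 0 else
    evalLM γ ∘ₗ ((S.i (S.rk γ - 1)).comp (restrCLM (S.Γs (S.rk γ - 1)))).toLinearMap

lemma coeff_apply_of_rk_ne_zero {γ : Γ} (h : S.rk γ ≠ 0) (x : Linf Γ) :
    coeff S γ x = x γ - S.i (S.rk γ - 1) (restrCLM (S.Γs (S.rk γ - 1)) x) γ := by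
  rw [coeff, if_neg h]
  rfl

lemma coeff_dvec (γ δ : Γ) [Decidable (γ = δ)] :
    coeff S γ (S.dvec δ) = if γ = δ then 1 else 0 := by
  by_cases h0 : S.rk γ = 0
  · rw [coeff, if_pos h0, sub_zero]
    exact dvec_apply S (by omega)
  · rw [coeff_apply_of_rk_ne_zero S h0]
    rcases lt_or_ge (S.rk δ) (S.rk γ) with h | h
    · rw [i_restrCLM_dvec S (by omega), sub_self, if_neg (by rintro rfl; omega)]
    · have hr : restrCLM (S.Γs (S.rk γ - 1)) (S.dvec δ) = 0 := by
        classical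
        ext η
        have hη := (mem_Γs_iff S).1 η.2
        rw [restrCLM_apply, dvec_apply S (by omega), if_neg (by rintro rfl; omega)]
        rfl
      rw [hr, map_zero, dvec_apply S h]
      simp

variable (γ₁ γ₂ : ℕ → Γ)

/-- The vector `d_γ + d_{γ₂^q}` if `γ = γ₁^q` for some `q ≥ 1`, and `d_γ` otherwise. -/
def pairVec (γ : Γ) : Linf Γ :=
  letI := Classical.propDecidable
  if 1 ≤ S.rk γ ∧ γ = γ₁ (S.rk γ) then S.dvec γ + S.dvec (γ₂ (S.rk γ)) else S.dvec γ

/-- The elements of `Γ_q` that are not of the form `γ₂^p` with `p ≥ 1`. -/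
def unpaired (q : ℕ) : Finset Γ :=
  letI := Classical.propDecidable
  (S.Γs q).filter fun γ => ¬(1 ≤ S.rk γ ∧ γ = γ₂ (S.rk γ))

/-- The finite dimensional pieces of `Z`. -/
def Zfin (q : ℕ) : Submodule ℝ (Linf Γ) :=
  Submodule.span ℝ (pairVec S γ₁ γ₂ '' (unpaired S γ₂ q : Set Γ))

variable {γ₁ γ₂}

lemma mem_unpaired {γ : Γ} {q : ℕ} :
    γ ∈ unpaired S γ₂ q ↔ S.rk γ ≤ q ∧ ¬(1 ≤ S.rk γ ∧ γ = γ₂ (S.rk γ)) := by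
  simp only [unpaired, Finset.mem_filter, mem_Γs_iff]

lemma Zfin_mono : Monotone (Zfin S γ₁ γ₂) := by
  intro p q hpq
  refine Submodule.span_mono (Set.image_mono fun γ hγ => ?_)
  simp only [Finset.mem_coe, mem_unpaired] at hγ ⊢
  exact ⟨hγ.1.trans hpq, hγ.2⟩

lemma pairVec_mem_space (γ : Γ) : pairVec S γ₁ γ₂ γ ∈ S.space := by
  unfold pairVec
  split_ifs
  · exact S.space.add_mem (dvec_mem S _) (dvec_mem S _)
  · exact dvec_mem S _

lemma Zfin_le_space (q : ℕ) : Zfin S γ₁ γ₂ q ≤ S.space := by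
  rw [Zfin, Submodule.span_le]
  rintro _ ⟨γ, -, rfl⟩
  exact pairVec_mem_space S γ

lemma coeff_pairVec (h₂ : ∀ q, 1 ≤ q → S.rk (γ₂ q) = q) {γ δ : Γ} [Decidable (γ = δ)]
    (hγ : ¬(1 ≤ S.rk γ ∧ γ = γ₂ (S.rk γ))) :
    coeff S γ (pairVec S γ₁ γ₂ δ) = if γ = δ then 1 else 0 := by
  classical
  unfold pairVec
  split_ifs with h h' h'
  · rw [map_add, coeff_dvec, coeff_dvec, if_pos h', if_neg, add_zero]
    intro h2
    subst h'
    exact hγ ⟨h.1, h2⟩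
  · rw [map_add, coeff_dvec, coeff_dvec, if_neg h', if_neg, add_zero]
    intro h2
    have h3 : S.rk γ = S.rk δ := by rw [h2, h₂ _ h.1]
    exact hγ ⟨h3 ▸ h.1, by rw [h3, ← h2]⟩
  · rw [coeff_dvec, if_pos h']
  · rw [coeff_dvec, if_neg h']

lemma finrank_Zfin (h₂ : ∀ q, 1 ≤ q → S.rk (γ₂ q) = q) (q : ℕ) :
    Module.finrank ℝ ↥(Zfin S γ₁ γ₂ q) = (unpaired S γ₂ q).card := by
  classical
  have hli : LinearIndependent ℝ fun γ : ↥(unpaired S γ₂ q) => pairVec S γ₁ γ₂ γ := by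
    refine LinearIndependent.of_comp
      (LinearMap.pi fun γ => coeff S (γ : Γ) : Linf Γ →ₗ[ℝ] (↥(unpaired S γ₂ q) → ℝ)) ?_
    refine Eq.subst (motive := fun w : _ → (↥(unpaired S γ₂ q) → ℝ) => LinearIndependent ℝ w) ?_
      (Pi.basisFun ℝ ↥(unpaired S γ₂ q)).linearIndependent
    symm
    ext δ γ
    rw [Function.comp_apply, LinearMap.pi_apply,
      coeff_pairVec S h₂ ((mem_unpaired S).1 γ.2).2, Pi.basisFun_apply, Pi.single_apply]
    simp only [Subtype.ext_iff]
  have := finrank_span_eq_card hli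
  rw [Fintype.card_coe] at this
  rw [← this, Zfin, Set.image_eq_range]
  rfl

lemma i_restrCLM_of_mem_Zfin {q : ℕ} {z : Linf Γ} (h₂ : ∀ q, 1 ≤ q → S.rk (γ₂ q) = q)
    (hz : z ∈ Zfin S γ₁ γ₂ q) :
    S.i q (restrCLM (S.Γs q) z) = z := by
  refine LinearMap.eqOn_span (f := ((S.i q).comp (restrCLM (S.Γs q))).toLinearMap)
    (g := LinearMap.id) ?_ hz
  rintro _ ⟨γ, hγ, rfl⟩
  have hγq := ((mem_unpaired S).1 hγ).1
  change S.i q (restrCLM (S.Γs q) _) = _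
  unfold pairVec
  split_ifs with h
  · rw [map_add, map_add, i_restrCLM_dvec S hγq, i_restrCLM_dvec S (by rwa [h₂ _ h.1])]
    rfl
  · exact i_restrCLM_dvec S hγq

lemma coeff_eq_of_mem_Zfin {q : ℕ} {z : Linf Γ} (h₁ : ∀ q, 1 ≤ q → S.rk (γ₁ q) = q)
    (h₂ : ∀ q, 1 ≤ q → S.rk (γ₂ q) = q) (hne : ∀ q, 1 ≤ q → γ₁ q ≠ γ₂ q)
    (hz : z ∈ Zfin S γ₁ γ₂ q) {p : ℕ} (hp : 1 ≤ p) :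
    coeff S (γ₁ p) z = coeff S (γ₂ p) z := by
  classical
  refine LinearMap.eqOn_span ?_ hz
  rintro _ ⟨δ, hδ, rfl⟩
  have hδ2 : γ₂ p ≠ δ := by
    rintro rfl
    exact ((mem_unpaired S).1 hδ).2 (by rw [h₂ p hp]; exact ⟨hp, rfl⟩)
  rw [coeff_pairVec S h₂ (by rw [h₁ p hp]; exact fun h => hne p hp h.2)]
  unfold pairVec
  split_ifs with h h' h'
  · rw [map_add, coeff_dvec, coeff_dvec, if_neg hδ2, if_pos (by rw [← h, h₁ p hp]), zero_add]
  · rw [coeff_dvec, if_neg hδ2]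
    exact absurd (by rw [← h, h₁ p hp]; exact ⟨hp, rfl⟩) h'
  · rw [map_add, coeff_dvec, coeff_dvec, if_neg hδ2, if_neg, zero_add]
    intro h2
    have h3 : p = S.rk δ := by rw [← h₂ p hp, h2, h₂ _ h'.1]
    exact h (by rw [h3, ← h'.2])
  · rw [coeff_dvec, if_neg hδ2]

lemma norm_le_of_mem_Zfin {q : ℕ} {z : Linf Γ} (h₁ : ∀ q, 1 ≤ q → S.rk (γ₁ q) = q)
    (h₂ : ∀ q, 1 ≤ q → S.rk (γ₂ q) = q) (hne : ∀ q, 1 ≤ q → γ₁ q ≠ γ₂ q)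
    {ε : ℝ} (hε : S.C * ε ≤ 1 / 2) (hε0 : 0 ≤ ε)
    (hclose : ∀ q, 1 ≤ q → ‖cAt S (q - 1) (γ₁ q) - cAt S (q - 1) (γ₂ q)‖ ≤ ε)
    (hz : z ∈ Zfin S γ₁ γ₂ q) {M : ℝ} (hM0 : 0 ≤ M)
    (hM : ∀ γ ∈ unpaired S γ₂ q, ‖z γ‖ ≤ M) :
    ‖z‖ ≤ 2 * S.C * M := by
  have hC := one_le_C S
  have key : ∀ γ ∈ S.Γs q, ‖z γ‖ ≤ M + ε * ‖z‖ := by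
    intro γ hγ
    have hεz : 0 ≤ ε * ‖z‖ := mul_nonneg hε0 (norm_nonneg z)
    rw [mem_Γs_iff] at hγ
    by_cases hγ2 : 1 ≤ S.rk γ ∧ γ = γ₂ (S.rk γ)
    · obtain ⟨hp, hγp⟩ := hγ2
      set p := S.rk γ with hpdef
      have h1 := hM (γ₁ p) ((mem_unpaired S).2
        ⟨by rwa [h₁ p hp], by rw [h₁ p hp]; exact fun h => hne p hp h.2⟩)
      have h2 := coeff_eq_of_mem_Zfin S h₁ h₂ hne hz hp
      rw [coeff_apply_of_rk_ne_zero S (by rw [h₁ p hp]; omega),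
        coeff_apply_of_rk_ne_zero S (by rw [h₂ p hp]; omega), h₁ p hp, h₂ p hp] at h2
      have h3 : ‖(cAt S (p - 1) (γ₁ p) - cAt S (p - 1) (γ₂ p)) ⟨z, Zfin_le_space S q hz⟩‖
          ≤ ε * ‖z‖ :=
        ContinuousLinearMap.le_of_opNorm_le _ (hclose p hp) _
      have h4 : (cAt S (p - 1) (γ₁ p) - cAt S (p - 1) (γ₂ p)) ⟨z, Zfin_le_space S q hz⟩
          = z (γ₁ p) - z (γ₂ p) := by
        change S.i (p - 1) (restrCLM (S.Γs (p - 1)) z) (γ₁ p) -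
          S.i (p - 1) (restrCLM (S.Γs (p - 1)) z) (γ₂ p) = _
        linarith
      rw [h4] at h3
      rw [hγp]
      have h5 := norm_sub_norm_le (z (γ₂ p)) (z (γ₁ p))
      rw [norm_sub_rev] at h5
      linarith
    · have := hM γ ((mem_unpaired S).2 ⟨hγ, hγ2⟩)
      linarith
  have h1 : ‖restrCLM (S.Γs q) z‖ ≤ M + ε * ‖z‖ :=
    (pi_norm_le_iff_of_nonneg (by positivity)).2 fun γ => key γ γ.2
  have h2 : ‖z‖ ≤ S.C * (M + ε * ‖z‖) := by
    conv_lhs => rw [← i_restrCLM_of_mem_Zfin S h₂ hz]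
    exact ((S.i q).le_opNorm _).trans
      (mul_le_mul (norm_i_le S q) h1 (norm_nonneg _) (by linarith))
  nlinarith [mul_le_mul_of_nonneg_right hε (norm_nonneg z)]

lemma exists_linearEquiv_Zfin (h₁ : ∀ q, 1 ≤ q → S.rk (γ₁ q) = q)
    (h₂ : ∀ q, 1 ≤ q → S.rk (γ₂ q) = q) (hne : ∀ q, 1 ≤ q → γ₁ q ≠ γ₂ q)
    {ε : ℝ} (hε : S.C * ε ≤ 1 / 2) (hε0 : 0 ≤ ε)
    (hclose : ∀ q, 1 ≤ q → ‖cAt S (q - 1) (γ₁ q) - cAt S (q - 1) (γ₂ q)‖ ≤ ε) (q : ℕ) :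
    ∃ (n : ℕ) (T : ↥(Zfin S γ₁ γ₂ q) ≃ₗ[ℝ] (Fin n → ℝ)),
      ∀ v, ‖T v‖ ≤ ‖v‖ ∧ ‖v‖ ≤ 2 * S.C * ‖T v‖ := by
  let e := (unpaired S γ₂ q).equivFin
  let R : ↥(Zfin S γ₁ γ₂ q) →ₗ[ℝ] (Fin (unpaired S γ₂ q).card → ℝ) :=
    LinearMap.pi fun j => evalLM (e.symm j : Γ) ∘ₗ (Zfin S γ₁ γ₂ q).subtype
  have hR : ∀ v, ‖v‖ ≤ 2 * S.C * ‖R v‖ := fun v =>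
    norm_le_of_mem_Zfin S h₁ h₂ hne hε hε0 hclose v.2 (norm_nonneg _) fun γ hγ => by
      have := norm_le_pi_norm (R v) (e ⟨γ, hγ⟩)
      change ‖(v : Linf Γ) (e.symm (e ⟨γ, hγ⟩))‖ ≤ _ at this
      rwa [Equiv.symm_apply_apply] at this
  have hinj : Function.Injective R := by
    rw [injective_iff_map_eq_zero]
    intro v hv
    have := hR v
    rw [hv, norm_zero, mul_zero] at this
    exact norm_le_zero_iff.1 this
  have : FiniteDimensional ℝ ↥(Zfin S γ₁ γ₂ q) :=
    FiniteDimensional.span_of_finite ℝ ((Finset.finite_toSet _).image _)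
  refine ⟨_, LinearEquiv.ofInjectiveOfFinrankEq R hinj ?_, fun v => ⟨?_, hR v⟩⟩
  · rw [finrank_Zfin S h₂, Module.finrank_fin_fun]
  · exact (pi_norm_le_iff_of_nonneg (norm_nonneg v)).2 fun j =>
      lp.norm_apply_le_norm ENNReal.top_ne_zero (v : Linf Γ) _

lemma pairVec_mem_Zsub (h₁ : ∀ q, 1 ≤ q → S.rk (γ₁ q) = q)
    (h₂ : ∀ q, 1 ≤ q → S.rk (γ₂ q) = q) {γ : Γ} (hγ : ¬(1 ≤ S.rk γ ∧ γ = γ₂ (S.rk γ))) :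
    pairVec S γ₁ γ₂ γ ∈ Zsub S γ₁ γ₂ := by
  refine Submodule.le_topologicalClosure _ (Submodule.subset_span ?_)
  unfold pairVec
  split_ifs with h
  · refine Or.inr ⟨S.rk γ - 1, ?_⟩
    have : S.rk γ - 1 + 1 = S.rk γ := by omega
    simp only [this]
    rw [← h.2]
  · refine Or.inl ⟨γ, ?_, rfl⟩
    rintro ⟨q, hq, rfl | rfl⟩
    · exact h (by rw [h₁ q hq]; exact ⟨hq, rfl⟩)
    · exact hγ (by rw [h₂ q hq]; exact ⟨hq, rfl⟩)

lemma Zfin_le_Zsub (h₁ : ∀ q, 1 ≤ q → S.rk (γ₁ q) = q)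
    (h₂ : ∀ q, 1 ≤ q → S.rk (γ₂ q) = q) (q : ℕ) : Zfin S γ₁ γ₂ q ≤ Zsub S γ₁ γ₂ := by
  rw [Zfin, Submodule.span_le]
  rintro _ ⟨γ, hγ, rfl⟩
  exact pairVec_mem_Zsub S h₁ h₂ ((mem_unpaired S).1 hγ).2

lemma Zsub_le_closure_iSup_Zfin (h₁ : ∀ q, 1 ≤ q → S.rk (γ₁ q) = q)
    (hne : ∀ q, 1 ≤ q → γ₁ q ≠ γ₂ q) :
    Zsub S γ₁ γ₂ ≤ (⨆ q, Zfin S γ₁ γ₂ q).topologicalClosure := by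
  have hmem : ∀ γ : Γ, ¬(1 ≤ S.rk γ ∧ γ = γ₂ (S.rk γ)) →
      pairVec S γ₁ γ₂ γ ∈ ⨆ q, Zfin S γ₁ γ₂ q := fun γ hγ =>
    Submodule.mem_iSup_of_mem (S.rk γ)
      (Submodule.subset_span ⟨γ, (mem_unpaired S).2 ⟨le_rfl, hγ⟩, rfl⟩)
  refine Submodule.topologicalClosure_mono (Submodule.span_le.2 ?_)
  rintro _ (⟨γ, hγ, rfl⟩ | ⟨q, rfl⟩)
  · have := hmem γ fun h => hγ ⟨_, h.1, Or.inr h.2⟩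
    unfold pairVec at this
    rwa [if_neg fun h => hγ ⟨_, h.1, Or.inl h.2⟩] at this
  · have hq : 1 ≤ q + 1 := by omega
    have := hmem (γ₁ (q + 1)) (by rw [h₁ _ hq]; exact fun h => hne _ hq h.2)
    unfold pairVec at this
    rwa [h₁ _ hq, if_pos ⟨hq, rfl⟩] at this

lemma exists_mem_Zfin_norm_sub_lt (h₁ : ∀ q, 1 ≤ q → S.rk (γ₁ q) = q)
    (hne : ∀ q, 1 ≤ q → γ₁ q ≠ γ₂ q) {x : Linf Γ} (hx : x ∈ Zsub S γ₁ γ₂) {ε : ℝ} (hε : 0 < ε) :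
    ∃ q, ∃ v ∈ Zfin S γ₁ γ₂ q, ‖v - x‖ < ε := by
  obtain ⟨v, hv, hvx⟩ := Metric.mem_closure_iff.1 (Zsub_le_closure_iSup_Zfin S h₁ hne hx) ε hε
  obtain ⟨q, hq⟩ := (Submodule.mem_iSup_of_directed _ (Zfin_mono S).directed_le).1 hv
  exact ⟨q, v, hq, by rwa [← dist_eq_norm, dist_comm]⟩

lemma not_finiteDimensional_Zsub (h₁ : ∀ q, 1 ≤ q → S.rk (γ₁ q) = q)
    (h₂ : ∀ q, 1 ≤ q → S.rk (γ₂ q) = q) (hne : ∀ q, 1 ≤ q → γ₁ q ≠ γ₂ q) :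
    ¬FiniteDimensional ℝ ↥(Zsub S γ₁ γ₂) := by
  intro h
  set n := Module.finrank ℝ ↥(Zsub S γ₁ γ₂)
  have h1 := Submodule.finrank_mono (Zfin_le_Zsub S h₁ h₂ (n + 1))
  rw [finrank_Zfin S h₂] at h1
  have h2 : (Finset.Icc 1 (n + 1)).card ≤ (unpaired S γ₂ (n + 1)).card := by
    refine Finset.card_le_card_of_injOn γ₁ (fun q hq => ?_) fun p hp q hq hpq => ?_
    · have hq := Finset.mem_Icc.1 hq
      refine (mem_unpaired S).2 ⟨by rw [h₁ q hq.1]; exact hq.2, ?_⟩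
      rw [h₁ q hq.1]
      exact fun h => hne q hq.1 h.2
    · rw [← h₁ p (Finset.mem_Icc.1 hp).1, hpq, h₁ q (Finset.mem_Icc.1 hq).1]
  rw [Nat.card_Icc] at h2
  omega

lemma isLinftySpace_Zsub (h₁ : ∀ q, 1 ≤ q → S.rk (γ₁ q) = q)
    (h₂ : ∀ q, 1 ≤ q → S.rk (γ₂ q) = q) (hne : ∀ q, 1 ≤ q → γ₁ q ≠ γ₂ q)
    {ε : ℝ} (hε : S.C * ε ≤ 1 / 2) (hε0 : 0 ≤ ε)
    (hclose : ∀ q, 1 ≤ q → ‖cAt S (q - 1) (γ₁ q) - cAt S (q - 1) (γ₂ q)‖ ≤ ε) :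
    IsLinftySpace ↥(Zsub S γ₁ γ₂) := by
  have hC := one_le_C S
  have hcomplete : CompleteSpace ↥(Zsub S γ₁ γ₂) :=
    (Submodule.isClosed_topologicalClosure _).completeSpace_coe
  refine ⟨3 * (2 * S.C), by linarith, IsLinftyCSpace.of_monotone_dense
    (V := fun q => (Zfin S γ₁ γ₂ q).comap (Zsub S γ₁ γ₂).subtype)
    (fun p q hpq => Submodule.comap_mono (Zfin_mono S hpq)) (fun x δ hδ => ?_) (by linarith)
    fun q => ?_⟩
  · obtain ⟨q, v, hv, hvx⟩ := exists_mem_Zfin_norm_sub_lt S h₁ hne x.2 hδ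
    exact ⟨q, ⟨v, Zfin_le_Zsub S h₁ h₂ q hv⟩, hv, hvx⟩
  · obtain ⟨n, T, hT⟩ := exists_linearEquiv_Zfin S h₁ h₂ hne hε hε0 hclose q
    exact ⟨n, (Submodule.comapSubtypeEquivOfLe (Zfin_le_Zsub S h₁ h₂ q)).trans T,
      fun v => hT (Submodule.comapSubtypeEquivOfLe (Zfin_le_Zsub S h₁ h₂ q) v)⟩

lemma Zsub_le_space : Zsub S γ₁ γ₂ ≤ S.space := by
  refine Submodule.topologicalClosure_mono (Submodule.span_le.2 ?_)
  have hd : ∀ γ, S.dvec γ ∈ Submodule.span ℝ (Set.range S.dvec) := fun γ =>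
    Submodule.subset_span ⟨γ, rfl⟩
  rintro _ (⟨γ, -, rfl⟩ | ⟨q, rfl⟩)
  · exact hd γ
  · exact Submodule.add_mem _ (hd _) (hd _)

end BD

/-- Let `𝔛` be a Bourgain–Delbaen space with `C = sup_q ‖i_q‖` and suppose
there are a decreasing sequence `(ε_q)_{q≥1}` of positive reals with `2C² ∑_q ε_q < 1` and, for
each `q ≥ 1`, distinct `γ₁^q, γ₂^q ∈ Δ_q` with
`‖e_{γ₁^q}^* ∘ i_p ∘ r_p - e_{γ₂^q}^* ∘ i_p ∘ r_p‖ < ε_q` for all `p < q`.  Then the closed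
linear span `Z` of `{d_γ : γ ∉ S} ∪ {d_{γ₁^q} + d_{γ₂^q} : q ≥ 1}`, where
`S = {γ₁^q, γ₂^q : q ≥ 1}`, is an infinite dimensional `L_∞`-subspace of `𝔛`. -/
theorem statement16 {Γ : Type*} (S : BD.System Γ) (εs : ℕ → ℝ) (γ₁ γ₂ : ℕ → Γ)
    (hpos : ∀ q, 1 ≤ q → 0 < εs q)
    (hdec : ∀ p q, 1 ≤ p → p ≤ q → εs q ≤ εs p)
    (hsummable : Summable fun q => εs (q + 1))
    (hsum : 2 * S.C ^ 2 * ∑' q : ℕ, εs (q + 1) < 1)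
    (hmem1 : ∀ q, 1 ≤ q → γ₁ q ∈ S.Δ q)
    (hmem2 : ∀ q, 1 ≤ q → γ₂ q ∈ S.Δ q)
    (hne : ∀ q, 1 ≤ q → γ₁ q ≠ γ₂ q)
    (hclose : ∀ q, 1 ≤ q → ∀ p, p < q →
      ‖BD.cAt S p (γ₁ q) - BD.cAt S p (γ₂ q)‖ < εs q) :
    BD.Zsub S γ₁ γ₂ ≤ S.space ∧
    ¬FiniteDimensional ℝ ↥(BD.Zsub S γ₁ γ₂) ∧
    IsLinftySpace ↥(BD.Zsub S γ₁ γ₂) := by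
  have h₁ := fun q hq => BD.rk_eq_of_mem_Δ S (hmem1 q hq)
  have h₂ := fun q hq => BD.rk_eq_of_mem_Δ S (hmem2 q hq)
  have hC := BD.one_le_C S
  have hε0 : 0 < εs 1 := hpos 1 le_rfl
  have hle : εs 1 ≤ ∑' q : ℕ, εs (q + 1) :=
    hsummable.le_tsum 0 fun q _ => (hpos (q + 1) (by omega)).le
  have hε : S.C * εs 1 ≤ 1 / 2 := by
    have hC2 : S.C ≤ S.C ^ 2 := le_self_pow₀ hC two_ne_zero
    have := mul_le_mul hC2 hle hε0.le (by positivity)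
    linarith
  exact ⟨BD.Zsub_le_space S, BD.not_finiteDimensional_Zsub S h₁ h₂ hne,
    BD.isLinftySpace_Zsub S h₁ h₂ hne hε hε0.le fun q hq =>
      (hclose q hq (q - 1) (by omega)).le.trans (hdec 1 q le_rfl hq)⟩
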